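/- There exist absolute constants 0 < c₁ < c₂ such that for every ε > 0 there is Q₀ with the following property: for all Q ≥ Q₀, the number of integers q ∈ [1, Q] that cannot be written as q = p₁·p₂·⋯·p_k·q₀ with p₁ > p₂ > ⋯ > p_k primes, c₁·log log log Q ≤ k ≤ c₂·log log log Q, and log Q/(log log Q)³ ≤ log q₀ ≤ log Q/(log log Q)², is at most ε·Q. -/

import Mathlib

open scoped Classical

section Anatomy

open Finset Real

/-- The sum of `log p / p` over the primes `p ≤ n`. -/
noncomputable def primeLogSum (n : ℕ) : ℝ := ∑ p ∈ Nat.primesLE n, log p / p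

/-- The sum of `1 / p` over the primes `p ≤ exp t`. -/
noncomputable def primeRecipSum (t : ℝ) : ℝ := ∑ p ∈ Nat.primesLE ⌊exp t⌋₊, (1 / p : ℝ)

/-- The largest divisor of `q` all of whose prime factors are at most `y`. -/
def smoothPart (y q : ℕ) : ℕ := ∏ p ∈ Nat.primesLE y, p ^ q.factorization p

lemma log_smoothPart (y q : ℕ) :
    log (smoothPart y q) = ∑ p ∈ Nat.primesLE y, (q.factorization p : ℝ) * log p := by
  rw [smoothPart, Nat.cast_prod, log_prod]
  · simp
  · intro p hp
    have := (Nat.prime_of_mem_primesLE hp).ne_zero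
    positivity

lemma sum_log_smoothPart (y n : ℕ) :
    ∑ q ∈ Icc 1 n, log (smoothPart y q) =
      ∑ p ∈ Nat.primesLE y, ((n.factorial).factorization p : ℝ) * log p := by
  simp_rw [log_smoothPart]
  rw [sum_comm]
  refine sum_congr rfl fun p _ ↦ ?_
  rw [← sum_mul, ← prod_Ico_id_eq_factorial, Nat.factorization_prod_apply
    (fun x hx ↦ by have := mem_Ico.1 hx; omega)]
  push_cast
  rfl

lemma smoothPart_eq_self {n q : ℕ} (hq : q ≠ 0) (h : ∀ p, p.Prime → p ∣ q → p ≤ n) :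
    smoothPart n q = q := by
  conv_rhs => rw [← Nat.prod_factorization_pow_eq_self hq]
  rw [Finsupp.prod, Nat.support_factorization, smoothPart]
  symm
  refine prod_subset (fun p hp ↦ ?_) fun p _ hp ↦ ?_
  · have hp' := Nat.prime_of_mem_primeFactors hp
    exact Nat.mem_primesLE.2 ⟨h p hp' (Nat.dvd_of_mem_primeFactors hp), hp'⟩
  · rw [← Nat.support_factorization, Finsupp.notMem_support_iff] at hp
    simp [hp]

lemma log_factorial_eq (n : ℕ) :
    log (n.factorial) = ∑ p ∈ Nat.primesLE n, ((n.factorial).factorization p : ℝ) * log p := by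
  rw [← log_smoothPart, smoothPart_eq_self n.factorial_ne_zero]
  exact fun p hp h ↦ (hp.dvd_factorial).1 h

lemma factorization_factorial_mul_log_le {p : ℕ} (hp : p.Prime) (n : ℕ) :
    ((n.factorial).factorization p : ℝ) * log p ≤ 2 * n * (log p / p) := by
  have h2 : (2 : ℝ) ≤ p := by exact_mod_cast hp.two_le
  have h : ((n.factorial).factorization p : ℝ) ≤ 2 * n / p := by
    refine (Nat.cast_le.2 (Nat.factorization_factorial_le_div_pred hp n)).trans ?_
    refine Nat.cast_div_le.trans ?_
    rw [Nat.cast_sub hp.one_le, div_le_div_iff₀ (by push_cast; linarith) (by linarith)]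
    push_cast
    nlinarith [(Nat.cast_nonneg n : (0 : ℝ) ≤ n)]
  calc _ ≤ 2 * n / p * log p := by
        gcongr
    _ = _ := by ring

lemma sum_log_smoothPart_le (y n : ℕ) :
    ∑ q ∈ Icc 1 n, log (smoothPart y q) ≤ 2 * n * primeLogSum y := by
  rw [sum_log_smoothPart, primeLogSum, mul_sum]
  exact sum_le_sum fun p hp ↦
    factorization_factorial_mul_log_le (Nat.prime_of_mem_primesLE hp) n

lemma primeLogSum_le {n : ℕ} (hn : 1 ≤ n) : primeLogSum n ≤ log n + log 4 := by
  have hn0 : (0 : ℝ) < n := by exact_mod_cast hn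
  have h1 : log (n.factorial) ≤ n * log n := by
    rw [← log_pow]
    exact log_le_log (by positivity) (by exact_mod_cast n.factorial_le_pow)
  have h2 : n * primeLogSum n - ∑ p ∈ Nat.primesLE n, log p ≤ log (n.factorial) := by
    rw [log_factorial_eq, primeLogSum, mul_sum, ← sum_sub_distrib]
    refine sum_le_sum fun p hp ↦ ?_
    have hpp := Nat.prime_of_mem_primesLE hp
    have h : n / p ≤ (n.factorial).factorization p := by
      rw [Nat.factorization_factorial hpp (Nat.lt_add_one _)]
      have hlog : 1 ≤ Nat.log p n :=
        Nat.log_pos hpp.one_lt (Nat.le_of_mem_primesLE hp)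
      simpa using single_le_sum (f := fun i ↦ n / p ^ i) (fun _ _ ↦ Nat.zero_le _)
        (mem_Ico.2 ⟨le_rfl, by omega⟩ : 1 ∈ Ico 1 (Nat.log p n + 1))
    have h' : (n : ℝ) / p - 1 ≤ (n.factorial).factorization p := by
      have := Nat.lt_floor_add_one ((n : ℝ) / p)
      rw [Nat.floor_div_eq_div] at this
      have h3 : ((n / p : ℕ) : ℝ) ≤ (n.factorial).factorization p := by exact_mod_cast h
      linarith
    calc _ = ((n : ℝ) / p - 1) * log p := by ring
      _ ≤ _ := by gcongr
  have h3 : ∑ p ∈ Nat.primesLE n, log p ≤ log 4 * n := by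
    rw [← Chebyshev.theta_eq_sum_primesLE_log]
    exact Chebyshev.theta_le_log4_mul_x hn0.le
  have : n * primeLogSum n ≤ n * (log n + log 4) := by linarith
  exact le_of_mul_le_mul_left this hn0

lemma le_primeLogSum {n : ℕ} (hn : 1 ≤ n) : log n - 1 ≤ 2 * primeLogSum n := by
  have hn0 : (0 : ℝ) < n := by exact_mod_cast hn
  have h1 : log (n.factorial) ≤ 2 * n * primeLogSum n := by
    rw [log_factorial_eq, primeLogSum, mul_sum]
    exact sum_le_sum fun p hp ↦
      factorization_factorial_mul_log_le (Nat.prime_of_mem_primesLE hp) n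
  have h2 : n * log n - n ≤ log (n.factorial) := by
    have h := pow_div_factorial_le_exp (n : ℝ) hn0.le n
    have h' := log_le_log (by positivity) h
    rw [log_exp, log_div (by positivity) (by positivity), log_pow] at h'
    linarith
  have : n * (log n - 1) ≤ n * (2 * primeLogSum n) := by linarith
  exact le_of_mul_le_mul_left this hn0

lemma log_four_le : log 4 ≤ 7 / 5 := by
  have : log 4 = 2 * log 2 := by
    rw [show (4 : ℝ) = 2 ^ 2 by norm_num, log_pow]; norm_num
  linarith [log_two_lt_d9]

lemma le_log_four : 5 / 4 ≤ log 4 := by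
  have : log 4 = 2 * log 2 := by
    rw [show (4 : ℝ) = 2 ^ 2 by norm_num, log_pow]; norm_num
  linarith [log_two_gt_d9]

lemma one_le_floor_exp {t : ℝ} (ht : 0 ≤ t) : 1 ≤ ⌊exp t⌋₊ :=
  Nat.le_floor (by simpa using one_le_exp ht)

lemma log_floor_exp_le {t : ℝ} (ht : 0 ≤ t) : log ⌊exp t⌋₊ ≤ t := by
  rw [log_le_iff_le_exp (by exact_mod_cast one_le_floor_exp ht)]
  exact Nat.floor_le (exp_pos t).le

lemma le_log_floor_exp {t : ℝ} (ht : 0 ≤ t) : t - 1 ≤ log ⌊exp t⌋₊ := by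
  have h1 : (1 : ℝ) ≤ ⌊exp t⌋₊ := by exact_mod_cast one_le_floor_exp ht
  have h2 := Nat.lt_floor_add_one (exp t)
  have h3 : exp t ≤ 2 * ⌊exp t⌋₊ := by linarith
  have h4 := log_le_log (exp_pos t) h3
  rw [log_exp, log_mul (by norm_num) (by positivity)] at h4
  linarith [log_two_lt_d9]

lemma floor_exp_mono {s t : ℝ} (h : s ≤ t) : ⌊exp s⌋₊ ≤ ⌊exp t⌋₊ :=
  Nat.floor_mono (exp_le_exp.2 h)

lemma primesLE_subset {m n : ℕ} (h : m ≤ n) : Nat.primesLE m ⊆ Nat.primesLE n := by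
  intro p hp
  rw [Nat.mem_primesLE] at hp ⊢
  exact ⟨hp.1.trans h, hp.2⟩

lemma primeRecipSum_sub {s t : ℝ} (h : s ≤ t) :
    primeRecipSum t - primeRecipSum s =
      ∑ p ∈ Nat.primesLE ⌊exp t⌋₊ \ Nat.primesLE ⌊exp s⌋₊, (1 / p : ℝ) := by
  rw [sub_eq_iff_eq_add, primeRecipSum, primeRecipSum,
    sum_sdiff (primesLE_subset (floor_exp_mono h))]

lemma primeRecipSum_mono : Monotone primeRecipSum := fun s t h ↦ by
  have := primeRecipSum_sub h
  have h2 : 0 ≤ ∑ p ∈ Nat.primesLE ⌊exp t⌋₊ \ Nat.primesLE ⌊exp s⌋₊, (1 / p : ℝ) :=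
    sum_nonneg fun _ _ ↦ by positivity
  linarith

lemma primeRecipSum_step {t : ℝ} (ht : 5 ≤ t) :
    1 / 8 ≤ primeRecipSum (4 * t) - primeRecipSum t ∧
      primeRecipSum (4 * t) - primeRecipSum t ≤ 5 := by
  have hle : t ≤ 4 * t := by linarith
  have ht0 : 0 < t := by linarith
  have hT : primeLogSum ⌊exp (4 * t)⌋₊ - primeLogSum ⌊exp t⌋₊ =
      ∑ p ∈ Nat.primesLE ⌊exp (4 * t)⌋₊ \ Nat.primesLE ⌊exp t⌋₊, log p / p := by
    rw [sub_eq_iff_eq_add, primeLogSum, primeLogSum,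
      sum_sdiff (primesLE_subset (floor_exp_mono hle))]
  have hmem : ∀ p ∈ Nat.primesLE ⌊exp (4 * t)⌋₊ \ Nat.primesLE ⌊exp t⌋₊,
      t ≤ log p ∧ log p ≤ 4 * t := by
    intro p hp
    rw [mem_sdiff, Nat.mem_primesLE, Nat.mem_primesLE] at hp
    obtain ⟨⟨h1, h2⟩, h3⟩ := hp
    have hp0 : (0 : ℝ) < p := by exact_mod_cast h2.pos
    have h4 : ⌊exp t⌋₊ < p := by
      by_contra h
      exact h3 ⟨by omega, h2⟩
    rw [le_log_iff_exp_le hp0, log_le_iff_le_exp hp0]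
    exact ⟨(Nat.lt_of_floor_lt h4).le, (Nat.le_floor_iff (exp_pos _).le).1 h1⟩
  have hup : t * (primeRecipSum (4 * t) - primeRecipSum t) ≤
      primeLogSum ⌊exp (4 * t)⌋₊ - primeLogSum ⌊exp t⌋₊ := by
    rw [hT, primeRecipSum_sub hle, mul_sum]
    refine sum_le_sum fun p hp ↦ ?_
    rw [mul_one_div]
    gcongr
    exact (hmem p hp).1
  have hlo : primeLogSum ⌊exp (4 * t)⌋₊ - primeLogSum ⌊exp t⌋₊ ≤
      4 * t * (primeRecipSum (4 * t) - primeRecipSum t) := by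
    rw [hT, primeRecipSum_sub hle, mul_sum]
    refine sum_le_sum fun p hp ↦ ?_
    rw [mul_one_div]
    gcongr
    exact (hmem p hp).2
  have a1 := primeLogSum_le (one_le_floor_exp (t := 4 * t) (by linarith))
  have a2 := primeLogSum_le (one_le_floor_exp ht0.le)
  have a3 := le_primeLogSum (one_le_floor_exp (t := 4 * t) (by linarith))
  have a4 : 0 ≤ primeLogSum ⌊exp t⌋₊ := sum_nonneg fun p _ ↦ by positivity
  have b1 := log_floor_exp_le (t := 4 * t) (by linarith)
  have b2 := log_floor_exp_le ht0.le
  have b3 := le_log_floor_exp (t := 4 * t) (by linarith)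
  have := log_four_le
  constructor
  · have : 4 * t * (1 / 8) ≤ 4 * t * (primeRecipSum (4 * t) - primeRecipSum t) := by linarith
    exact le_of_mul_le_mul_left this (by linarith)
  · have : t * (primeRecipSum (4 * t) - primeRecipSum t) ≤ t * 5 := by linarith
    exact le_of_mul_le_mul_left this ht0

lemma primeRecipSum_iterate {t : ℝ} (ht : 5 ≤ t) (j : ℕ) :
    j / 8 ≤ primeRecipSum (4 ^ j * t) - primeRecipSum t ∧
      primeRecipSum (4 ^ j * t) - primeRecipSum t ≤ 5 * j := by
  induction j with
  | zero => simp
  | succ j ih =>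
    have h1 : (1 : ℝ) ≤ 4 ^ j := one_le_pow₀ (by norm_num)
    have := primeRecipSum_step (t := 4 ^ j * t) (by nlinarith)
    rw [pow_succ', mul_assoc]
    push_cast
    constructor <;> linarith [this.1, this.2, ih.1, ih.2]

/-- A weak form of Mertens' second theorem. -/
lemma primeRecipSum_sub_bounds {s t : ℝ} (hs : 5 ≤ s) (hst : s ≤ t) :
    (log (t / s) / log 4 - 1) / 8 ≤ primeRecipSum t - primeRecipSum s ∧
      primeRecipSum t - primeRecipSum s ≤ 5 * (log (t / s) / log 4 + 1) := by
  have hs0 : 0 < s := by linarith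
  have h4 : 0 < log 4 := by linarith [le_log_four]
  have hr : 1 ≤ t / s := (one_le_div hs0).2 hst
  have hx : 0 ≤ log (t / s) / log 4 := div_nonneg (log_nonneg hr) h4.le
  obtain ⟨j, hj⟩ : ∃ j, j = ⌊log (t / s) / log 4⌋₊ := ⟨_, rfl⟩
  have hj1 : j ≤ log (t / s) / log 4 := hj ▸ Nat.floor_le hx
  have hj2 : log (t / s) / log 4 < j + 1 := hj ▸ Nat.lt_floor_add_one _
  have e1 : 4 ^ j * s ≤ t := by
    rw [← le_div_iff₀ hs0, ← log_le_log_iff (by positivity) (by linarith), log_pow]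
    exact (le_div_iff₀ h4).1 hj1
  have e2 : t ≤ 4 ^ (j + 1) * s := by
    rw [← div_le_iff₀ hs0, ← log_le_log_iff (by linarith) (by positivity), log_pow]
    push_cast
    exact ((div_lt_iff₀ h4).1 hj2).le
  have m1 := primeRecipSum_mono e1
  have m2 := primeRecipSum_mono e2
  have i1 := (primeRecipSum_iterate hs j).1
  have i2 := (primeRecipSum_iterate hs (j + 1)).2
  push_cast at i2
  constructor <;> linarith

/-- The Turán–Kubilius inequality for the number of prime divisors in a given set. -/
lemma sum_sq_card_dvd_sub_le (n : ℕ) (P : Finset ℕ) (hP : P ⊆ Nat.primesLE n) :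
    ∑ q ∈ Icc 1 n, ((#{p ∈ P | p ∣ q} : ℝ) - ∑ p ∈ P, (1 / p : ℝ)) ^ 2 ≤
      3 * n * ∑ p ∈ P, (1 / p : ℝ) := by
  obtain ⟨M, hM⟩ : ∃ M, M = ∑ p ∈ P, (1 / p : ℝ) := ⟨_, rfl⟩
  have hM0 : 0 ≤ M := hM ▸ sum_nonneg fun _ _ ↦ by positivity
  have hcount (d : ℕ) : ∑ q ∈ Icc 1 n, (if d ∣ q then (1 : ℝ) else 0) = ((n / d : ℕ) : ℝ) := by
    rw [sum_boole, ← Nat.Ioc_filter_dvd_card_eq_div]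
    rfl
  have hw (q : ℕ) : (#{p ∈ P | p ∣ q} : ℝ) = ∑ p ∈ P, if p ∣ q then (1 : ℝ) else 0 := by
    rw [sum_boole]
  have hcard : (#P : ℝ) ≤ n := by
    have : P ⊆ Icc 1 n := fun p hp ↦ by
      have := Nat.mem_primesLE.1 (hP hp)
      exact mem_Icc.2 ⟨this.2.one_le, this.1⟩
    have := card_le_card this
    rw [Nat.card_Icc] at this
    exact_mod_cast this
  have h1 : n * M - n ≤ ∑ q ∈ Icc 1 n, (#{p ∈ P | p ∣ q} : ℝ) := by
    simp_rw [hw]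
    rw [sum_comm]
    simp_rw [hcount]
    have : ∑ p ∈ P, ((n : ℝ) / p - 1) ≤ ∑ p ∈ P, ((n / p : ℕ) : ℝ) := by
      refine sum_le_sum fun p _ ↦ ?_
      have := Nat.lt_floor_add_one ((n : ℝ) / p)
      rw [Nat.floor_div_eq_div] at this
      linarith
    rw [sum_sub_distrib] at this
    simp only [sum_const, nsmul_eq_mul, mul_one] at this
    have h' : n * M = ∑ p ∈ P, (n : ℝ) / p := by
      rw [hM, mul_sum]
      simp_rw [mul_one_div]
    linarith
  have h2 : ∑ q ∈ Icc 1 n, (#{p ∈ P | p ∣ q} : ℝ) ^ 2 ≤ n * M ^ 2 + n * M := by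
    simp_rw [hw, sq, sum_mul_sum]
    rw [sum_comm]
    have hin (p : ℕ) : ∑ q ∈ Icc 1 n, ∑ r ∈ P,
        (if p ∣ q then (1 : ℝ) else 0) * (if r ∣ q then (1 : ℝ) else 0) =
        ∑ r ∈ P, ∑ q ∈ Icc 1 n,
          (if p ∣ q then (1 : ℝ) else 0) * (if r ∣ q then (1 : ℝ) else 0) := sum_comm
    simp_rw [hin]
    have hterm : ∀ p ∈ P, ∀ r ∈ P, ∑ q ∈ Icc 1 n,
        (if p ∣ q then (1 : ℝ) else 0) * (if r ∣ q then (1 : ℝ) else 0) ≤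
        n * ((1 / p) * (1 / r)) + if p = r then n * (1 / p : ℝ) else 0 := by
      intro p hp r hr
      have hpp := Nat.prime_of_mem_primesLE (hP hp)
      have hrp := Nat.prime_of_mem_primesLE (hP hr)
      by_cases hpr : p = r
      · subst hpr
        have : ∀ q, (if p ∣ q then (1 : ℝ) else 0) * (if p ∣ q then (1 : ℝ) else 0) =
            if p ∣ q then (1 : ℝ) else 0 := fun q ↦ by split_ifs <;> simp
        simp_rw [this, hcount]
        have h3 : ((n / p : ℕ) : ℝ) ≤ n / p := Nat.cast_div_le
        have h4 : (0 : ℝ) ≤ n * ((1 / p) * (1 / p)) := by positivity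
        rw [if_pos trivial, mul_one_div (n : ℝ) (p : ℝ)]
        linarith
      · have hc : Nat.Coprime p r := (Nat.coprime_primes hpp hrp).2 hpr
        have : ∀ q, (if p ∣ q then (1 : ℝ) else 0) * (if r ∣ q then (1 : ℝ) else 0) =
            if p * r ∣ q then (1 : ℝ) else 0 := fun q ↦ by
          rw [mul_ite, mul_one, mul_zero, ← ite_and]
          exact if_congr ⟨fun h ↦ hc.mul_dvd_of_dvd_of_dvd h.2 h.1,
            fun h ↦ ⟨dvd_of_mul_left_dvd h, dvd_of_mul_right_dvd h⟩⟩ rfl rfl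
        simp_rw [this, hcount, if_neg hpr]
        have h3 : ((n / (p * r) : ℕ) : ℝ) ≤ n / ((p * r : ℕ) : ℝ) := Nat.cast_div_le
        refine h3.trans (le_of_eq ?_)
        push_cast
        rw [add_zero, one_div_mul_one_div, mul_one_div]
    calc _ ≤ ∑ p ∈ P, ∑ r ∈ P,
          (n * ((1 / p) * (1 / r)) + if p = r then n * (1 / p : ℝ) else 0) :=
          sum_le_sum fun p hp ↦ sum_le_sum fun r hr ↦ hterm p hp r hr
      _ = n * (M * M) + n * M := by
        simp_rw [sum_add_distrib]
        congr 1
        · rw [hM, sum_mul_sum, mul_sum]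
          simp_rw [mul_sum]
        · rw [hM, mul_sum]
          exact sum_congr rfl fun p hp ↦ by rw [sum_ite_eq, if_pos hp]
  have h3 : ∑ q ∈ Icc 1 n, ((#{p ∈ P | p ∣ q} : ℝ) - M) ^ 2 =
      ∑ q ∈ Icc 1 n, (#{p ∈ P | p ∣ q} : ℝ) ^ 2 -
        2 * M * ∑ q ∈ Icc 1 n, (#{p ∈ P | p ∣ q} : ℝ) + n * M ^ 2 := by
    rw [mul_sum, ← sum_sub_distrib]
    have : (n : ℝ) * M ^ 2 = ∑ q ∈ Icc 1 n, M ^ 2 := by simp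
    rw [this, ← sum_add_distrib]
    exact sum_congr rfl fun q _ ↦ by ring
  rw [← hM, h3]
  nlinarith [mul_le_mul_of_nonneg_left h1 hM0]

/-- Most integers up to `n` have about the expected number of prime divisors in `P`. -/
lemma card_deviation_le (n : ℕ) (P : Finset ℕ) (hP : P ⊆ Nat.primesLE n) {M : ℝ}
    (hM : M = ∑ p ∈ P, (1 / p : ℝ)) (hM0 : 0 < M) :
    (#{q ∈ Icc 1 n | M / 2 ≤ |(#{p ∈ P | p ∣ q} : ℝ) - M|} : ℝ) ≤ 12 / M * n := by
  have h := sum_sq_card_dvd_sub_le n P hP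
  rw [← hM] at h
  have h2 : (#{q ∈ Icc 1 n | M / 2 ≤ |(#{p ∈ P | p ∣ q} : ℝ) - M|} : ℝ) * (M / 2) ^ 2 ≤
      ∑ q ∈ Icc 1 n, ((#{p ∈ P | p ∣ q} : ℝ) - M) ^ 2 := by
    rw [← nsmul_eq_mul]
    refine (card_nsmul_le_sum _ _ _ fun q hq ↦ ?_).trans
      (sum_le_sum_of_subset_of_nonneg (filter_subset _ _) fun _ _ _ ↦ sq_nonneg _)
    rw [← sq_abs (_ - M)]
    exact pow_le_pow_left₀ (by linarith) (mem_filter.1 hq).2 2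
  rw [div_mul_eq_mul_div, le_div_iff₀ hM0]
  nlinarith

lemma card_sq_dvd_le (n y : ℕ) :
    (#{q ∈ Icc 1 n | ∃ p, y < p ∧ p ^ 2 ∣ q} : ℝ) ≤ 2 / (y + 1) * n := by
  have hsub : {q ∈ Icc 1 n | ∃ p, y < p ∧ p ^ 2 ∣ q} ⊆
      (Ioo y (n + 1)).biUnion fun p ↦ {q ∈ Ioc 0 n | p ^ 2 ∣ q} := by
    intro q hq
    obtain ⟨hq, p, hp, hd⟩ := mem_filter.1 hq
    have hq := mem_Icc.1 hq
    have h1 : p ≤ n := ((Nat.le_self_pow two_ne_zero p).trans (Nat.le_of_dvd hq.1 hd)).trans hq.2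
    simp only [mem_biUnion, mem_filter, mem_Ioo, mem_Ioc]
    exact ⟨p, ⟨hp, by omega⟩, by omega, hd⟩
  have h1 : (#{q ∈ Icc 1 n | ∃ p, y < p ∧ p ^ 2 ∣ q} : ℝ) ≤
      ∑ p ∈ Ioo y (n + 1), ((n / p ^ 2 : ℕ) : ℝ) := by
    have := (card_le_card hsub).trans card_biUnion_le
    simp_rw [Nat.Ioc_filter_dvd_card_eq_div] at this
    exact_mod_cast this
  calc _ ≤ ∑ p ∈ Ioo y (n + 1), n * ((p : ℝ) ^ 2)⁻¹ := h1.trans <| sum_le_sum fun p _ ↦ by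
        refine Nat.cast_div_le.trans ?_
        rw [div_eq_mul_inv]
        push_cast
        rfl
    _ = n * ∑ p ∈ Ioo y (n + 1), ((p : ℝ) ^ 2)⁻¹ := by rw [mul_sum]
    _ ≤ n * (2 / (y + 1)) := by
        gcongr
        exact sum_Ioo_inv_sq_le y (n + 1)
    _ = _ := by ring

lemma card_log_smoothPart_le {n y : ℕ} (hy : 1 ≤ y) {B : ℝ} (hB : 0 < B) :
    (#{q ∈ Icc 1 n | B < log (smoothPart y q)} : ℝ) ≤ 2 * (log y + log 4) / B * n := by
  have h0 : ∀ q, 0 ≤ log (smoothPart y q) := fun q ↦ log_natCast_nonneg _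
  have h : (#{q ∈ Icc 1 n | B < log (smoothPart y q)} : ℝ) * B ≤
      ∑ q ∈ Icc 1 n, log (smoothPart y q) := by
    rw [← nsmul_eq_mul]
    exact (card_nsmul_le_sum _ _ _ fun q hq ↦ (mem_filter.1 hq).2.le).trans
      (sum_le_sum_of_subset_of_nonneg (filter_subset _ _) fun q _ _ ↦ h0 q)
  have h2 := h.trans (sum_log_smoothPart_le y n)
  have h3 := primeLogSum_le hy
  rw [div_mul_eq_mul_div, le_div_iff₀ hB]
  nlinarith [(Nat.cast_nonneg n : (0 : ℝ) ≤ n)]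

lemma eq_prod_mul_smoothPart {q y : ℕ} (hq : q ≠ 0) (hsq : ∀ p, y < p → ¬p ^ 2 ∣ q) :
    q = (∏ p ∈ q.primeFactors with y < p, p) * smoothPart y q := by
  have h : smoothPart y q = ∏ p ∈ q.primeFactors with ¬y < p, p ^ q.factorization p := by
    symm
    refine prod_subset (fun p hp ↦ ?_) fun p hp1 hp ↦ ?_
    · rw [mem_filter] at hp
      exact Nat.mem_primesLE.2 ⟨by omega, Nat.prime_of_mem_primeFactors hp.1⟩
    · have := Nat.le_of_mem_primesLE hp1
      rw [mem_filter, not_and', ← Nat.support_factorization, Finsupp.notMem_support_iff] at hp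
      simp [hp (by omega)]
  have h2 : ∏ p ∈ q.primeFactors with y < p, p =
      ∏ p ∈ q.primeFactors with y < p, p ^ q.factorization p := by
    refine prod_congr rfl fun p hp ↦ ?_
    obtain ⟨hp, hyp⟩ := mem_filter.1 hp
    have hpp := Nat.prime_of_mem_primeFactors hp
    have h1 : 1 ≤ q.factorization p :=
      (hpp.dvd_iff_one_le_factorization hq).1 (Nat.dvd_of_mem_primeFactors hp)
    have h3 : ¬2 ≤ q.factorization p := fun h ↦
      hsq p hyp ((hpp.pow_dvd_iff_le_factorization hq).2 h)
    rw [show q.factorization p = 1 by omega, pow_one]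
  rw [h, h2, prod_filter_mul_prod_filter_not]
  exact (Nat.prod_factorization_pow_eq_self hq).symm

lemma log_le_log_smoothPart {p q y : ℕ} (hq : q ≠ 0) (hp : p.Prime) (hy : p ≤ y) (hd : p ∣ q) :
    log p ≤ log (smoothPart y q) := by
  have h1 : p ∣ smoothPart y q :=
    (dvd_pow_self p (Nat.one_le_iff_ne_zero.1 ((hp.dvd_iff_one_le_factorization hq).1 hd))).trans
      (dvd_prod_of_mem _ (Nat.mem_primesLE.2 ⟨hy, hp⟩))
  have h0 : 0 < smoothPart y q := prod_pos fun r hr ↦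
    pow_pos (Nat.prime_of_mem_primesLE hr).pos _
  exact log_le_log (by exact_mod_cast hp.pos) (by exact_mod_cast Nat.le_of_dvd h0 h1)

lemma exists_strictAnti_prod (S : Finset ℕ) :
    ∃ p : Fin #S → ℕ, (∀ i, p i ∈ S) ∧ StrictAnti p ∧ ∏ i, p i = ∏ x ∈ S, x := by
  refine ⟨fun i ↦ S.orderEmbOfFin rfl i.rev, fun i ↦ orderEmbOfFin_mem _ _ _,
    fun i j h ↦ (S.orderEmbOfFin rfl).strictMono (Fin.rev_lt_rev.2 h), ?_⟩
  refine (Equiv.prod_comp Fin.revPerm fun i ↦ S.orderEmbOfFin rfl i).trans ?_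
  conv_rhs => rw [← map_orderEmbOfFin_univ S rfl, prod_map]
  rfl

/-- `q` is a product of a strictly decreasing sequence of `k` primes and of an integer `q₀`, with
`a ≤ k ≤ b` and `s ≤ log q₀ ≤ B`. -/
def HasAnatomy (a b s B : ℝ) (q : ℕ) : Prop :=
  ∃ (k : ℕ) (p : Fin k → ℕ) (q₀ : ℕ), (∀ i, (p i).Prime) ∧ StrictAnti p ∧
    a ≤ (k : ℝ) ∧ (k : ℝ) ≤ b ∧ s ≤ log q₀ ∧ log q₀ ≤ B ∧ q = (∏ i, p i) * q₀

lemma HasAnatomy.mono {a a' b b' s B : ℝ} {q : ℕ} (h : HasAnatomy a b s B q) (ha : a' ≤ a)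
    (hb : b ≤ b') : HasAnatomy a' b' s B q := by
  obtain ⟨k, p, q₀, h1, h2, h3, h4, h5⟩ := h
  exact ⟨k, p, q₀, h1, h2, ha.trans h3, h4.trans hb, h5⟩

lemma card_not_hasAnatomy_le {n : ℕ} (hn : 1 ≤ n) {s t B M N : ℝ} (hs : 0 ≤ s) (hst : s ≤ t)
    (htn : t ≤ log n) (hB : 0 < B) (hM : M = primeRecipSum t - primeRecipSum s) (hM0 : 0 < M)
    (hN : N = primeRecipSum (log n) - primeRecipSum t) (hN0 : 0 < N) :
    (#{q ∈ Icc 1 n | ¬HasAnatomy (N / 2) (3 * N / 2) s B q} : ℝ) ≤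
      (2 * (t + log 4) / B + 12 / M + 12 / N + 2 / exp t) * n := by
  have hfl : ⌊exp (log n)⌋₊ = n := by
    rw [exp_log (by exact_mod_cast hn), Nat.floor_natCast]
  obtain ⟨y, hy⟩ : ∃ y, y = ⌊exp t⌋₊ := ⟨_, rfl⟩
  obtain ⟨P, hP⟩ : ∃ P, P = Nat.primesLE ⌊exp t⌋₊ \ Nat.primesLE ⌊exp s⌋₊ := ⟨_, rfl⟩
  obtain ⟨R, hR⟩ : ∃ R, R = Nat.primesLE n \ Nat.primesLE ⌊exp t⌋₊ := ⟨_, rfl⟩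
  have hyn : ⌊exp t⌋₊ ≤ n := hfl ▸ floor_exp_mono htn
  rw [primeRecipSum_sub hst, ← hP] at hM
  rw [primeRecipSum_sub htn, hfl, ← hR] at hN
  have ht : 0 ≤ t := hs.trans hst
  have hy1 : 1 ≤ y := hy ▸ one_le_floor_exp ht
  have c1 := card_log_smoothPart_le (n := n) hy1 hB
  have c2 := card_deviation_le n P (hP ▸ sdiff_subset.trans (primesLE_subset hyn)) hM hM0
  have c3 := card_deviation_le n R (hR ▸ sdiff_subset) hN hN0
  have c4 := card_sq_dvd_le n y
  have hsub : {q ∈ Icc 1 n | ¬HasAnatomy (N / 2) (3 * N / 2) s B q} ⊆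
      {q ∈ Icc 1 n | B < log (smoothPart y q)} ∪
      {q ∈ Icc 1 n | M / 2 ≤ |(#{p ∈ P | p ∣ q} : ℝ) - M|} ∪
      {q ∈ Icc 1 n | N / 2 ≤ |(#{p ∈ R | p ∣ q} : ℝ) - N|} ∪
      {q ∈ Icc 1 n | ∃ p, y < p ∧ p ^ 2 ∣ q} := by
    intro q hq
    obtain ⟨hqn, hq⟩ := mem_filter.1 hq
    by_contra hcon
    simp only [mem_union, mem_filter, hqn, true_and, not_or, not_lt, not_le, not_exists,
      not_and] at hcon
    obtain ⟨⟨⟨h1, h2⟩, h3⟩, h4⟩ := hcon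
    have hqn := mem_Icc.1 hqn
    have hq0 : q ≠ 0 := by omega
    refine hq ?_
    have hS : {p ∈ R | p ∣ q} = {p ∈ q.primeFactors | y < p} := by
      ext p
      simp only [hR, hy, mem_filter, mem_sdiff, Nat.mem_primesLE, Nat.mem_primeFactors]
      constructor
      · rintro ⟨⟨⟨h5, h6⟩, h7⟩, h8⟩
        exact ⟨⟨h6, h8, hq0⟩, by by_contra h; exact h7 ⟨by omega, h6⟩⟩
      · rintro ⟨⟨h6, h8, -⟩, h7⟩
        exact ⟨⟨⟨(Nat.le_of_dvd hqn.1 h8).trans hqn.2, h6⟩, fun h ↦ by omega⟩, h8⟩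
    obtain ⟨p, hp1, hp2, hp3⟩ := exists_strictAnti_prod {p ∈ R | p ∣ q}
    rw [abs_lt] at h2 h3
    refine ⟨_, p, smoothPart y q, fun i ↦ ?_, hp2, by linarith, by linarith, ?_, h1, ?_⟩
    · have := (mem_filter.1 (hp1 i)).1
      rw [hR] at this
      exact Nat.prime_of_mem_primesLE (mem_sdiff.1 this).1
    · have hpos : (0 : ℝ) < #{p ∈ P | p ∣ q} := by linarith
      obtain ⟨r, hr⟩ := card_pos.1 (Nat.cast_pos.1 hpos)
      simp only [hP, ← hy, mem_filter, mem_sdiff, Nat.mem_primesLE] at hr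
      obtain ⟨⟨⟨h5, h6⟩, h7⟩, h8⟩ := hr
      refine le_trans ?_ (log_le_log_smoothPart hq0 h6 h5 h8)
      rw [le_log_iff_exp_le (by exact_mod_cast h6.pos)]
      refine (Nat.lt_of_floor_lt ?_).le
      by_contra h
      exact h7 ⟨by omega, h6⟩
    · rw [hp3, hS]
      exact eq_prod_mul_smoothPart hq0 h4
  have hcard : (#{q ∈ Icc 1 n | ¬HasAnatomy (N / 2) (3 * N / 2) s B q} : ℝ) ≤
      #{q ∈ Icc 1 n | B < log (smoothPart y q)} +
      #{q ∈ Icc 1 n | M / 2 ≤ |(#{p ∈ P | p ∣ q} : ℝ) - M|} +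
      #{q ∈ Icc 1 n | N / 2 ≤ |(#{p ∈ R | p ∣ q} : ℝ) - N|} +
      #{q ∈ Icc 1 n | ∃ p, y < p ∧ p ^ 2 ∣ q} := by
    refine (Nat.cast_le.2 (card_le_card hsub)).trans ?_
    exact_mod_cast (card_union_le _ _).trans <| Nat.add_le_add_right ((card_union_le _ _).trans <|
      Nat.add_le_add_right (card_union_le _ _) _) _
  have d1 : 2 * (log y + log 4) / B * n ≤ 2 * (t + log 4) / B * n := by
    gcongr
    exact hy ▸ log_floor_exp_le ht
  have d4 : 2 / ((y : ℝ) + 1) * n ≤ 2 / exp t * n := by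
    gcongr
    exact hy ▸ (Nat.lt_floor_add_one _).le
  linarith

open Filter in
lemma tendsto_sqrt_log_log : Tendsto (fun n : ℕ ↦ √(log (log n))) atTop atTop :=
  tendsto_sqrt_atTop.comp <| tendsto_log_atTop.comp <| tendsto_log_atTop.comp
    tendsto_natCast_atTop_atTop

open Filter in
lemma eventually_pow_mul_le_exp_sq :
    ∀ᶠ u : ℝ in atTop, (u + 5) * u ^ 6 ≤ exp (u ^ 2) := by
  have h := (tendsto_pow_mul_exp_neg_atTop_nhds_zero 4).comp
    (tendsto_pow_atTop (α := ℝ) two_ne_zero)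
  filter_upwards [h.eventually (gt_mem_nhds one_pos), eventually_ge_atTop 6] with u h1 h2
  simp only [Function.comp, exp_neg, ← div_eq_mul_inv] at h1
  rw [div_lt_one (exp_pos _)] at h1
  have h3 : (u + 5) ≤ u ^ 2 := by nlinarith
  calc (u + 5) * u ^ 6 ≤ u ^ 2 * u ^ 6 := by gcongr
    _ = (u ^ 2) ^ 4 := by ring
    _ ≤ _ := h1.le

lemma card_not_hasAnatomy_log_le {n : ℕ} (hn : 1 ≤ n) {u : ℝ} (hu : 6 ≤ u)
    (hlu : 10 ≤ log u) (hn2 : log n = exp (u ^ 2)) (hexp : (u + 5) * u ^ 6 ≤ exp (u ^ 2)) :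
    (#{q ∈ Icc 1 n | ¬HasAnatomy (log u / 8) (38 * log u)
      (log n / u ^ 6) (log n / u ^ 4) q} : ℝ) ≤ (6 / u + 240 / log u) * n := by
  have hu0 : 0 < u := by linarith
  have hL := log_four_le
  have hL1 := le_log_four
  have hL0 : 0 < log 4 := by linarith
  have hln : 0 < log n := hn2 ▸ exp_pos _
  obtain ⟨s, hs⟩ : ∃ s, s = log n / u ^ 6 := ⟨_, rfl⟩
  obtain ⟨t, ht⟩ : ∃ t, t = log n / u ^ 5 := ⟨_, rfl⟩
  have hs5 : u + 5 ≤ s := by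
    rw [hs, le_div_iff₀ (by positivity), hn2]
    exact hexp
  have hts : t = u * s := by rw [ht, hs]; field_simp
  have hst : s ≤ t := by nlinarith
  have hnt : log n = u ^ 5 * t := by rw [ht]; field_simp
  have htn : t ≤ log n := by
    rw [hnt]
    exact le_mul_of_one_le_left (by linarith) (one_le_pow₀ (by linarith))
  have hBt : log n / u ^ 4 = u * t := by rw [ht]; field_simp
  have ht0 : 0 < t := by linarith
  have hs0 : 0 < s := by linarith
  have b1 := (primeRecipSum_sub_bounds (by linarith) hst).1
  have b2 := primeRecipSum_sub_bounds (by linarith) htn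
  have e1 : t / s = u := by rw [hts]; field_simp
  have e2 : log n / t = u ^ 5 := by rw [hnt]; field_simp
  rw [e1] at b1
  rw [e2, log_pow] at b2
  push_cast at b2
  rw [mul_div_assoc] at b2
  have f1 : 5 / 7 * log u ≤ log u / log 4 := by
    rw [le_div_iff₀ hL0]
    nlinarith
  have f2 : log u / log 4 ≤ 4 / 5 * log u := by
    rw [div_le_iff₀ hL0]
    nlinarith
  have hM : log u / 16 ≤ primeRecipSum t - primeRecipSum s := by linarith
  have hN : log u / 4 ≤ primeRecipSum (log n) - primeRecipSum t := by linarith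
  have hN' : primeRecipSum (log n) - primeRecipSum t ≤ 25 * log u := by linarith
  have h := card_not_hasAnatomy_le hn (s := s) (t := t) (B := u * t) (by linarith) hst htn
    (by positivity) rfl (by linarith) rfl (by linarith)
  rw [hBt, ← hs]
  refine (Nat.cast_le.2 (card_le_card ?_)).trans (h.trans ?_)
  · exact monotone_filter_right _ fun q _ hq h ↦ hq (h.mono (by linarith) (by linarith))
  · gcongr ?_ * _
    have g1 : 2 * (t + log 4) / (u * t) ≤ 4 / u := by
      rw [div_le_div_iff₀ (by positivity) hu0]
      nlinarith
    have g2 : 12 / (primeRecipSum t - primeRecipSum s) ≤ 12 / (log u / 16) := by gcongr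
    have g3 : 12 / (primeRecipSum (log n) - primeRecipSum t) ≤ 12 / (log u / 4) := by gcongr
    have g4 : 2 / exp t ≤ 2 / u := by
      gcongr
      linarith [add_one_le_exp t]
    have g5 : 12 / (log u / 16) = 192 / log u := by field_simp; norm_num
    have g6 : 12 / (log u / 4) = 48 / log u := by field_simp; norm_num
    have g7 : 6 / u + 240 / log u = 4 / u + 192 / log u + 48 / log u + 2 / u := by ring
    linarith

end Anatomy

/-- anatomy of integers: there are absolute constants `0 < c₁ < c₂` such that
for every `ε > 0` there is `Q₀` with: for all `Q ≥ Q₀`, the number of `q ∈ [1, Q]` that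
cannot be written as `q = p₁⋯p_k·q₀` with `p₁ > ⋯ > p_k` primes,
`c₁·logloglog Q ≤ k ≤ c₂·logloglog Q`, and
`log Q/(log log Q)³ ≤ log q₀ ≤ log Q/(log log Q)²`, is at most `ε·Q`. -/
theorem stmt13 :
    ∃ c₁ c₂ : ℝ, 0 < c₁ ∧ c₁ < c₂ ∧
      ∀ ε : ℝ, 0 < ε → ∃ Q₀ : ℕ, ∀ Q : ℕ, Q₀ ≤ Q →
        (((Finset.Icc 1 Q).filter (fun q : ℕ =>
            ¬∃ (k : ℕ) (p : Fin k → ℕ) (q₀ : ℕ),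
              (∀ i, (p i).Prime) ∧ StrictAnti p ∧
              c₁ * Real.log (Real.log (Real.log Q)) ≤ (k : ℝ) ∧
              (k : ℝ) ≤ c₂ * Real.log (Real.log (Real.log Q)) ∧
              Real.log Q / (Real.log (Real.log Q)) ^ 3 ≤ Real.log q₀ ∧
              Real.log q₀ ≤ Real.log Q / (Real.log (Real.log Q)) ^ 2 ∧
              q = (∏ i, p i) * q₀)).card : ℝ)
          ≤ ε * Q := by
  refine ⟨1 / 16, 19, by norm_num, by norm_num, fun ε hε ↦ ?_⟩
  have hlim : Filter.Tendsto (fun u : ℝ ↦ 6 / u + 240 / Real.log u) Filter.atTop (nhds 0) := by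
    simpa using (Filter.tendsto_id.const_div_atTop (6 : ℝ)).add
      (Real.tendsto_log_atTop.const_div_atTop (240 : ℝ))
  obtain ⟨Q₀, hQ₀⟩ := Filter.eventually_atTop.1 <| (Filter.eventually_ge_atTop 1).and <|
    tendsto_sqrt_log_log.eventually <| (hlim.eventually (gt_mem_nhds hε)).and <|
    (Filter.eventually_ge_atTop 6).and <|
    (Real.tendsto_log_atTop.eventually_ge_atTop 10).and eventually_pow_mul_le_exp_sq
  refine ⟨Q₀, fun Q hQ ↦ ?_⟩
  obtain ⟨h1, h2, h3, h4, h5⟩ := hQ₀ Q hQ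
  obtain ⟨u, hu⟩ : ∃ u, u = √(Real.log (Real.log Q)) := ⟨_, rfl⟩
  rw [← hu] at h2 h3 h4 h5
  have hll : Real.log (Real.log Q) = u ^ 2 := by
    rw [hu, Real.sq_sqrt]
    by_contra h
    rw [Real.sqrt_eq_zero_of_nonpos (by linarith)] at hu
    linarith
  have hl : Real.log Q = Real.exp (u ^ 2) := by
    rw [← hll, Real.exp_log]
    refine lt_of_le_of_ne (Real.log_natCast_nonneg _) fun h ↦ ?_
    rw [← h, Real.log_zero] at hll
    nlinarith
  have hlll : Real.log (Real.log (Real.log Q)) = 2 * Real.log u := by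
    rw [hll, Real.log_pow]
    norm_num
  have h := (card_not_hasAnatomy_log_le h1 h3 h4 hl h5).trans
    (mul_le_mul_of_nonneg_right h2.le (Nat.cast_nonneg Q))
  rw [hlll, hll, ← pow_mul, ← pow_mul, show 1 / 16 * (2 * Real.log u) = Real.log u / 8 by ring,
    show 19 * (2 * Real.log u) = 38 * Real.log u by ring]
  exact h
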